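/- arXiv:1408.0560 — 2 statements merged into one kernel-verified Lean document; each statement's English description precedes it below -/
import Mathlib

section
/- A rank-one minimal IC POVM on ℂ^d is tight IC if and only if it is a (rank-one) SIC measurement. -/
open Matrix ComplexOrder

noncomputable section

abbrev Mat (d : ℕ) := Matrix (Fin d) (Fin d) ℂ

/-- The real vector space of Hermitian `d × d` complex matrices. -/
abbrev HermM (d : ℕ) : Submodule ℝ (Mat d) := selfAdjoint.submodule ℝ (Mat d)

/-- The identity matrix as a Hermitian matrix. -/
def hermOne (d : ℕ) : HermM d := ⟨1, IsSelfAdjoint.one (Mat d)⟩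

/-- The superoperator `|A⟩⟩⟨⟨B| : X ↦ tr(B X) • A` on Hermitian matrices. -/
def outerSO (d : ℕ) (A B : HermM d) : HermM d →ₗ[ℝ] HermM d :=
  (Complex.reLm ∘ₗ Matrix.traceLinearMap (Fin d) ℝ ℂ ∘ₗ
    LinearMap.mulLeft ℝ (B : Mat d) ∘ₗ (HermM d).subtype).smulRight A


lemma aux_rank {d : ℕ} (A : Mat d) (h : A.rank = 1) : (A * A).trace = A.trace ^ 2 := by
  have h' : Module.finrank ℂ (LinearMap.range A.mulVecLin) = 1 := h
  obtain ⟨u, -, hu⟩ := finrank_eq_one_iff'.1 h'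
  have hc : ∀ j, ∃ c : ℂ, ∀ i, A i j = c * u.1 i := by
    intro j
    obtain ⟨c, hc⟩ := hu ⟨A.mulVecLin (Pi.single j 1), ⟨_, rfl⟩⟩
    refine ⟨c, fun i => ?_⟩
    have := congrFun (congrArg Subtype.val hc) i
    simp at this
    rw [this]
  choose c hc using hc
  simp only [Matrix.trace, Matrix.diag, Matrix.mul_apply, hc, sq, Finset.sum_mul_sum]
  refine Finset.sum_congr rfl fun i _ => Finset.sum_congr rfl fun j _ => ?_
  ring

lemma aux_li {d : ℕ} (P : Fin (d ^ 2) → HermM d)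
    (hIC : ∀ A : Mat d, A.IsHermitian →
      A ∈ Submodule.span ℝ (Set.range fun j => (P j : Mat d))) :
    LinearIndependent ℝ P := by
  have h1 : LinearIndependent ℂ (fun j => (P j : Mat d)) := by
    apply linearIndependent_of_top_le_span_of_card_eq_finrank
    · intro A _
      have key : ∀ B : Mat d, B.IsHermitian →
          B ∈ Submodule.span ℂ (Set.range fun j => (P j : Mat d)) := fun B hB =>
        Submodule.span_le_restrictScalars ℝ ℂ _ (hIC B hB)
      have hA := realPart_add_I_smul_imaginaryPart A
      rw [← hA]
      exact Submodule.add_mem _ (key _ (realPart A).2) (Submodule.smul_mem _ _ (key _ (imaginaryPart A).2))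
    · simp [Module.finrank_matrix, sq]
  have h2 : LinearIndependent ℝ (fun j => (P j : Mat d)) :=
    h1.restrict_scalars (by
      intro a b hab
      simpa using hab)
  exact LinearIndependent.of_comp (HermM d).subtype h2

lemma outer_apply {d : ℕ} (A B X : HermM d) :
    outerSO d A B X = ((B : Mat d) * (X : Mat d)).trace.re • A := rfl

theorem rankOne_minimal_tightIC_iff_SIC (d : ℕ) (hd : 2 ≤ d)
    (P : Fin (d ^ 2) → HermM d)
    (hpsd : ∀ j, ((P j : Mat d)).PosSemidef)
    (hrank : ∀ j, (P j : Mat d).rank = 1)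
    (hsum : ∑ j, (P j : Mat d) = 1)
    (hIC : ∀ A : Mat d, A.IsHermitian →
      A ∈ Submodule.span ℝ (Set.range fun j => (P j : Mat d))) :
    (∃ α β : ℝ, 0 < α ∧ 0 < β ∧
      (d : ℝ) • ∑ j, ((Matrix.trace (P j : Mat d)).re)⁻¹ • outerSO d (P j) (P j) =
        α • LinearMap.id + β • outerSO d (hermOne d) (hermOne d)) ↔
    (∀ j k, (Matrix.trace ((P j : Mat d) * (P k : Mat d))).re =
      ((d : ℝ) * (if j = k then 1 else 0) + 1) / ((d : ℝ) ^ 2 * (d + 1))) := by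
  have hd0 : (2 : ℝ) ≤ d := by exact_mod_cast hd
  have hdp : (0 : ℝ) < d := by linarith
  have hli := aux_li P hIC
  have hone : hermOne d = ∑ j, P j := by
    apply Subtype.ext
    rw [AddSubmonoidClass.coe_finsetSum, hsum]; rfl
  have ht : ∀ j, 0 < (Matrix.trace (P j : Mat d)).re ∧ (Matrix.trace (P j : Mat d)).im = 0 := by
    intro j
    have h0 := (hpsd j).trace_nonneg
    have h1 : (P j : Mat d).trace ≠ 0 := by
      intro h
      have := (hpsd j).trace_eq_zero_iff.1 h
      have h2 := hrank j
      rw [this] at h2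
      simp at h2
    have h2 := lt_of_le_of_ne h0 h1.symm
    rw [Complex.lt_def] at h2
    exact ⟨h2.1, h2.2.symm⟩
  have hgj : ∀ j, (Matrix.trace ((P j : Mat d) * (P j : Mat d))).re
      = (Matrix.trace (P j : Mat d)).re ^ 2 := by
    intro j
    rw [aux_rank _ (hrank j), sq, Complex.mul_re, (ht j).2]; ring
  have hgs : ∀ k, ∑ j, (Matrix.trace ((P j : Mat d) * (P k : Mat d))).re
      = (Matrix.trace (P k : Mat d)).re := by
    intro k
    rw [← Complex.re_sum, ← Matrix.trace_sum, ← Finset.sum_mul, hsum, one_mul]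
  have hts : ∑ j, (Matrix.trace (P j : Mat d)).re = d := by
    rw [← Complex.re_sum, ← Matrix.trace_sum, hsum]; simp
  have ht0 : ∀ j, 0 < (Matrix.trace (P j : Mat d)).re := fun j => (ht j).1
  -- expansions on P k
  have hL : ∀ k, ((d : ℝ) • ∑ j, ((Matrix.trace (P j : Mat d)).re)⁻¹ • outerSO d (P j) (P j)) (P k)
      = ∑ j, (d * ((Matrix.trace (P j : Mat d)).re)⁻¹ *
        (Matrix.trace ((P j : Mat d) * (P k : Mat d))).re) • P j := by
    intro k
    simp only [LinearMap.smul_apply, LinearMap.sum_apply, outer_apply, Finset.smul_sum, smul_smul,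
      mul_assoc]
  have hR : ∀ (α β : ℝ) k, (α • LinearMap.id + β • outerSO d (hermOne d) (hermOne d) : HermM d →ₗ[ℝ] HermM d) (P k)
      = ∑ j, (α * (if j = k then 1 else 0) + β * (Matrix.trace (P k : Mat d)).re) • P j := by
    intro α β k
    have : ((hermOne d : HermM d) : Mat d) = 1 := rfl
    simp only [LinearMap.smul_apply, LinearMap.add_apply, outer_apply, this, one_mul,
      LinearMap.id_apply, add_smul, Finset.sum_add_distrib, smul_smul]
    rw [← Finset.smul_sum, ← hone]
    simp
  generalize hT : (fun j => (Matrix.trace (P j : Mat d)).re) = t at *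
  have hT' : ∀ j, (Matrix.trace (P j : Mat d)).re = t j := fun j => congrFun hT j
  simp only [hT'] at *
  constructor
  · rintro ⟨α, β, hα, hβ, h⟩
    have hc : ∀ j k, d * (t j)⁻¹ * (Matrix.trace ((P j : Mat d) * (P k : Mat d))).re
        = α * (if j = k then 1 else 0) + β * t k := by
      intro j k
      have h1 := congrArg (fun f => f (P k)) h
      simp only [hL, hR] at h1
      exact hli.eq_coords_of_eq h1 j
    have hg : ∀ j k, (Matrix.trace ((P j : Mat d) * (P k : Mat d))).re
        = t j / d * (α * (if j = k then 1 else 0) + β * t k) := by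
      intro j k
      rw [← hc]
      have := (ht0 j).ne'
      field_simp
    have hd1 : ∀ j, d * t j = α + β * t j := by
      intro j
      have h1 := hc j j
      rw [hgj] at h1
      have := (ht0 j).ne'
      simp at h1
      rw [← h1]; field_simp
    let j0 : Fin (d ^ 2) := ⟨0, by positivity⟩
    have hne : (d : ℝ) - β ≠ 0 := by
      intro h0
      have := hd1 j0
      have h3 : ((d : ℝ) - β) * t j0 = α := by linarith
      rw [h0, zero_mul] at h3
      linarith
    have hconst : ∀ j, t j = t j0 := by
      intro j
      apply mul_left_cancel₀ hne
      linarith [hd1 j, hd1 j0]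
    have htv : ∀ j, t j = 1 / d := by
      have h1 := hts
      simp only [hconst] at h1
      simp at h1
      intro j
      rw [hconst]
      field_simp
      have : (d : ℝ) * (d * t j0) = d * 1 := by linarith
      linarith [mul_left_cancel₀ hdp.ne' this]
    have hs : α + β * d = d := by
      have h1 := hgs j0
      simp only [hg, htv, mul_add, Finset.sum_add_distrib] at h1
      simp at h1
      field_simp at h1
      linarith
    have h2 := hd1 j0
    rw [htv] at h2
    have hβv : β = d / (d + 1) := by
      field_simp at h2 ⊢
      have : (d - 1 : ℝ) ≠ 0 := by linarith
      apply mul_left_cancel₀ this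
      linear_combination d * hs + h2
    have hαv : α = d / (d + 1) := by
      have : α = d - β * d := by linarith
      rw [this, hβv]; field_simp; ring
    intro j k
    rw [hg, htv, htv, hαv, hβv]
    field_simp
  · intro h
    have htv : ∀ j, t j = 1 / d := by
      intro j
      have h1 := hgj j
      rw [h j j] at h1
      simp at h1
      have h2 : t j ^ 2 = (1 / d) ^ 2 := by
        rw [← h1]; field_simp
      exact (pow_left_inj₀ (ht0 j).le (by positivity) two_ne_zero).1 h2
    refine ⟨d / (d + 1), d / (d + 1), by positivity, by positivity, ?_⟩
    have hsp : Submodule.span ℝ (Set.range P) = ⊤ := by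
      rw [eq_top_iff]
      rintro X -
      have h1 := hIC X.1 X.2
      have h2 : (Set.range fun j => (P j : Mat d)) = (HermM d).subtype '' Set.range P := by
        rw [← Set.range_comp]; rfl
      rw [h2, Submodule.span_image] at h1
      obtain ⟨Y, hY, hYX⟩ := h1
      rwa [← Subtype.ext hYX]
    apply LinearMap.ext_on_range hsp
    intro k
    rw [hL, hR]
    refine Finset.sum_congr rfl fun j _ => ?_
    congr 1
    rw [h, htv, htv]
    field_simp
end
end

section
/- In linear quantum state tomography with any IC POVM of average purity 𝓅 on ℂ^d, the average scaled MSE over unitarily equivalent states, Tr(F⁻¹) − tr(ρ²), is bounded below by (d²−1)²/(d²𝓅 − d) − [tr(ρ²) − 1/d], with equality if and only if the POVM is tight IC. -/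
open Matrix ComplexOrder

noncomputable section

open Module in
theorem aux_trace_pos {V : Type*} [AddCommGroup V] [Module ℝ V] [FiniteDimensional ℝ V]
    (B : V →ₗ[ℝ] V →ₗ[ℝ] ℝ) (hs : ∀ x y, B x y = B y x) (hp : ∀ x, x ≠ 0 → 0 < B x x)
    (F G E : V →ₗ[ℝ] V) (hFp : ∀ x, x ≠ 0 → 0 < B (F x) x)
    (hFG : ∀ x, F (G x) = x) (hE : ∀ x y, B (E x) y = B x (E y)) :
    0 ≤ LinearMap.trace ℝ V (G ∘ₗ E ∘ₗ E) ∧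
      (LinearMap.trace ℝ V (G ∘ₗ E ∘ₗ E) = 0 → E = 0) := by
  let core : InnerProductSpace.Core ℝ V :=
    { inner := fun x y => B x y
      conj_inner_symm := fun x y => by simpa using hs y x
      re_inner_nonneg := fun x => by
        by_cases h : x = 0
        · simp [h]
        · simpa using (hp x h).le
      add_left := fun x y z => by simp
      smul_left := fun x y r => by simp
      definite := fun x hx => by
        by_contra h
        exact (hp x h).ne' hx }
  let i1 : NormedAddCommGroup V := core.toNormedAddCommGroup
  let i2 : InnerProductSpace ℝ V := InnerProductSpace.ofCore core.toCore
  have hin : ∀ x y : V, inner ℝ x y = B x y := fun x y => rfl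
  let b := stdOrthonormalBasis ℝ V
  have key : LinearMap.trace ℝ V (G ∘ₗ E ∘ₗ E) =
      ∑ i, B (F (G (E (b i)))) (G (E (b i))) := by
    have h1 : LinearMap.trace ℝ V (G ∘ₗ E ∘ₗ E) = LinearMap.trace ℝ V (E ∘ₗ (G ∘ₗ E)) := by
      rw [← LinearMap.comp_assoc, LinearMap.trace_comp_comm']
    rw [h1, LinearMap.trace_eq_sum_inner _ b]
    refine Finset.sum_congr rfl fun i _ => ?_
    rw [hin, hFG, hE]
    rfl
  have hnn : ∀ x, 0 ≤ B (F x) x := fun x => by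
    by_cases h : x = 0
    · simp [h]
    · exact (hFp x h).le
  refine ⟨key ▸ Finset.sum_nonneg fun i _ => hnn _, fun h0 => ?_⟩
  rw [key, Finset.sum_eq_zero_iff_of_nonneg (fun i _ => hnn _)] at h0
  refine b.toBasis.ext fun i => ?_
  have h2 : G (E (b i)) = 0 := by
    by_contra h
    exact (hFp _ h).ne' (h0 i (Finset.mem_univ _))
  have h3 := hFG (E (b i))
  rw [h2, map_zero] at h3
  simpa using h3.symm

theorem aux_main {V : Type*} [AddCommGroup V] [Module ℝ V] [FiniteDimensional ℝ V]
    (B : V →ₗ[ℝ] V →ₗ[ℝ] ℝ) (hs : ∀ x y, B x y = B y x) (hp : ∀ x, x ≠ 0 → 0 < B x x)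
    (F G : V →ₗ[ℝ] V) (hFp : ∀ x, x ≠ 0 → 0 < B (F x) x)
    (hFs : ∀ x y, B (F x) y = B x (F y))
    (hFG : ∀ x, F (G x) = x) (hGF : ∀ x, G (F x) = x)
    (u : V) (δ α β : ℝ) (hδ : 0 < δ) (hu : F u = δ • u) (huu : B u u = δ) :
    0 ≤ LinearMap.trace ℝ V F - 2 * α * Module.finrank ℝ V - 2 * β * δ + 2 * α * β + β ^ 2 * δ
        + α ^ 2 * LinearMap.trace ℝ V G ∧
      (LinearMap.trace ℝ V F - 2 * α * Module.finrank ℝ V - 2 * β * δ + 2 * α * β + β ^ 2 * δ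
        + α ^ 2 * LinearMap.trace ℝ V G = 0 ↔
        F = α • LinearMap.id + β • (B u).smulRight u) := by
  set K := (B u).smulRight u with hK
  have hKx : ∀ x, K x = B u x • u := fun x => by simp [hK]
  set E := F - α • LinearMap.id - β • K with hEdef
  have hEx : ∀ x, E x = F x - α • x - (β * B u x) • u := fun x => by
    simp [hEdef, hKx, smul_smul]
  have hGu : G u = δ⁻¹ • u := by
    have := hGF u
    rw [hu, map_smul] at this
    rw [← this, smul_smul, inv_mul_cancel₀ hδ.ne', one_smul, this]
  have hBF : ∀ x, B u (F x) = δ * B u x := fun x => by rw [← hFs, hu]; simp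
  have hEs : ∀ x y, B (E x) y = B x (E y) := fun x y => by
    simp only [hEx, map_sub, map_smul, LinearMap.sub_apply, LinearMap.smul_apply, smul_eq_mul, hFs,
      hs x u]
    ring
  have hcomp : G ∘ₗ E ∘ₗ E = F - (2 * α) • LinearMap.id + (α ^ 2) • G
      + (-2 * β + 2 * α * β / δ + β ^ 2) • K := by
    ext x
    simp only [LinearMap.comp_apply, hEx, map_sub, map_smul, hGF, hGu, hu, hBF, huu, hKx,
      LinearMap.add_apply, LinearMap.sub_apply, LinearMap.smul_apply, LinearMap.id_apply,
      smul_eq_mul]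
    match_scalars <;> field_simp <;> ring
  have htr : LinearMap.trace ℝ V (G ∘ₗ E ∘ₗ E) =
      LinearMap.trace ℝ V F - 2 * α * Module.finrank ℝ V - 2 * β * δ + 2 * α * β + β ^ 2 * δ
        + α ^ 2 * LinearMap.trace ℝ V G := by
    rw [hcomp]
    simp only [map_add, map_sub, map_smul, LinearMap.trace_id, smul_eq_mul, hK,
      LinearMap.trace_smulRight, huu]
    field_simp
    ring
  obtain ⟨h1, h2⟩ := aux_trace_pos B hs hp F G E hFp hFG hEs
  rw [htr] at h1 h2
  refine ⟨h1, fun h => ?_, fun h => ?_⟩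
  · have := h2 h
    rw [hEdef, sub_sub, sub_eq_zero] at this
    exact this
  · have : E = 0 := by rw [hEdef, h]; abel
    rw [← htr, this]
    simp

theorem aux_finrank (d : ℕ) : Module.finrank ℝ (HermM d) = d ^ 2 := by
  let e : Mat d ≃ₗ[ℝ] (HermM d × HermM d) :=
    LinearEquiv.ofBijective ((realPart (A := Mat d)).prod (imaginaryPart (A := Mat d))) (by
      constructor
      · intro x y h
        have h1 := congrArg Prod.fst h
        have h2 := congrArg Prod.snd h
        change realPart x = realPart y at h1
        change imaginaryPart x = imaginaryPart y at h2
        rw [← realPart_add_I_smul_imaginaryPart x, ← realPart_add_I_smul_imaginaryPart y, h1, h2]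
      · rintro ⟨a, b⟩
        refine ⟨(a : Mat d) + Complex.I • (b : Mat d), ?_⟩
        have ha : realPart (a : Mat d) = a := selfAdjoint.realPart_coe
        have hb : realPart (b : Mat d) = b := selfAdjoint.realPart_coe
        have ha' : imaginaryPart (a : Mat d) = 0 := selfAdjoint.imaginaryPart_coe
        have hb' : imaginaryPart (b : Mat d) = 0 := selfAdjoint.imaginaryPart_coe
        refine Prod.ext ?_ ?_
        · change realPart ((a : Mat d) + Complex.I • (b : Mat d)) = a
          rw [map_add, realPart_I_smul, ha, hb', neg_zero, add_zero]
        · change imaginaryPart ((a : Mat d) + Complex.I • (b : Mat d)) = b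
          rw [map_add, imaginaryPart_I_smul, ha', hb, zero_add])
  have h := e.finrank_eq
  rw [Module.finrank_prod, Module.finrank_matrix] at h
  simp at h
  nlinarith

/-- Hilbert-Schmidt form. -/
def hsB (d : ℕ) : HermM d →ₗ[ℝ] HermM d →ₗ[ℝ] ℝ :=
  LinearMap.mk₂ ℝ (fun X Y => (Matrix.trace ((X : Mat d) * (Y : Mat d))).re)
    (by intros; simp [add_mul]) (by intros; simp)
    (by intros; simp [mul_add]) (by intros; simp)

theorem hsB_apply (d : ℕ) (X Y : HermM d) :
    hsB d X Y = (Matrix.trace ((X : Mat d) * (Y : Mat d))).re := rfl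

theorem outer_eq (d : ℕ) (A B : HermM d) : outerSO d A B = (hsB d B).smulRight A := rfl

theorem hsB_symm (d : ℕ) (X Y : HermM d) : hsB d X Y = hsB d Y X := by
  rw [hsB_apply, hsB_apply, Matrix.trace_mul_comm]

theorem hsB_pos (d : ℕ) (X : HermM d) (h : X ≠ 0) : 0 < hsB d X X := by
  have hX : (X : Mat d)ᴴ = X := X.2
  have h0 : 0 ≤ Matrix.trace ((X : Mat d)ᴴ * (X : Mat d)) :=
    (Matrix.posSemidef_conjTranspose_mul_self _).trace_nonneg
  have h1 : Matrix.trace ((X : Mat d)ᴴ * (X : Mat d)) ≠ 0 := fun h2 =>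
    h (Subtype.ext (Matrix.trace_conjTranspose_mul_self_eq_zero_iff.1 h2))
  have h2 := lt_of_le_of_ne h0 h1.symm
  rw [hX] at h2
  rw [hsB_apply]
  exact (Complex.lt_def.1 h2).1

theorem hsB_le (d : ℕ) (X : HermM d) (h : (X : Mat d).PosSemidef) :
    hsB d X X ≤ (Matrix.trace (X : Mat d)).re ^ 2 := by
  have hX : (X : Mat d).IsHermitian := X.2
  have h1 : Matrix.trace ((X : Mat d) * (X : Mat d)) = ∑ i, ((hX.eigenvalues i : ℂ)) ^ 2 := by
    have hs := hX.spectral_theorem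
    have h3 : (X : Mat d) * (X : Mat d) = Unitary.conjStarAlgAut ℂ _ hX.eigenvectorUnitary
        (diagonal (RCLike.ofReal ∘ hX.eigenvalues) * diagonal (RCLike.ofReal ∘ hX.eigenvalues)) := by
      rw [map_mul, ← hs]
    rw [h3, Unitary.conjStarAlgAut_apply, Matrix.trace_mul_cycle]
    simp [pow_two, Matrix.trace_diagonal]
  have h2 : Matrix.trace (X : Mat d) = ∑ i, (hX.eigenvalues i : ℂ) := hX.trace_eq_sum_eigenvalues
  rw [hsB_apply, h1, h2]
  norm_cast
  exact Finset.sum_sq_le_sq_sum_of_nonneg fun i _ => h.eigenvalues_nonneg i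

/-- In linear state tomography with any IC POVM of average purity 𝓅,
the average scaled MSE Tr(F⁻¹) − tr(ρ²) is bounded below by
(d²−1)²/(d²𝓅 − d) − [tr(ρ²) − 1/d], with equality iff the POVM is tight IC. -/
theorem IC_POVM_average_MSE_bound (d n : ℕ) (hd : 2 ≤ d)
    (P : Fin n → HermM d) (𝓅 : ℝ)
    (hpsd : ∀ j, ((P j : Mat d)).PosSemidef)
    (htrpos : ∀ j, 0 < (Matrix.trace (P j : Mat d)).re)
    (hsum : ∑ j, (P j : Mat d) = 1)
    (hIC : ∀ A : Mat d, A.IsHermitian →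
      A ∈ Submodule.span ℝ (Set.range fun j => (P j : Mat d)))
    (h𝓅 : 𝓅 = (∑ j, (Matrix.trace ((P j : Mat d) * (P j : Mat d))).re /
      (Matrix.trace (P j : Mat d)).re) / d)
    (ρ : Mat d) (hρ : ρ.PosSemidef) (hρtr : Matrix.trace ρ = 1)
    (G : HermM d →ₗ[ℝ] HermM d)
    (hGF : G ∘ₗ ((d : ℝ) • ∑ j,
      ((Matrix.trace (P j : Mat d)).re)⁻¹ • outerSO d (P j) (P j)) = LinearMap.id)
    (hFG : ((d : ℝ) • ∑ j,
      ((Matrix.trace (P j : Mat d)).re)⁻¹ • outerSO d (P j) (P j)) ∘ₗ G = LinearMap.id) :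
    ((d : ℝ) ^ 2 - 1) ^ 2 / ((d : ℝ) ^ 2 * 𝓅 - d) -
        ((Matrix.trace (ρ * ρ)).re - 1 / d) ≤
      LinearMap.trace ℝ (HermM d) G - (Matrix.trace (ρ * ρ)).re ∧
    (LinearMap.trace ℝ (HermM d) G - (Matrix.trace (ρ * ρ)).re =
        ((d : ℝ) ^ 2 - 1) ^ 2 / ((d : ℝ) ^ 2 * 𝓅 - d) -
          ((Matrix.trace (ρ * ρ)).re - 1 / d) ↔
      ∃ α β : ℝ, 0 < α ∧ 0 < β ∧
        (d : ℝ) • (∑ j, ((Matrix.trace (P j : Mat d)).re)⁻¹ • outerSO d (P j) (P j)) =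
          α • LinearMap.id + β • outerSO d (hermOne d) (hermOne d)) := by
  have hd0 : (0 : ℝ) < d := by exact_mod_cast (by omega : 0 < d)
  have hd2 : (2 : ℝ) ≤ d := by exact_mod_cast hd
  have hm : (0 : ℝ) < (d : ℝ) ^ 2 - 1 := by nlinarith
  set t : Fin n → ℝ := fun j => (Matrix.trace (P j : Mat d)).re with ht
  set F : HermM d →ₗ[ℝ] HermM d := (d : ℝ) • ∑ j, (t j)⁻¹ • outerSO d (P j) (P j) with hF
  set u := hermOne d with hu
  have hFx : ∀ x, F x = (d : ℝ) • ∑ j, ((t j)⁻¹ * hsB d (P j) x) • P j := fun x => by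
    simp [hF, outer_eq, LinearMap.sum_apply, smul_smul]
  have hBF : ∀ x y, hsB d (F x) y = d * ∑ j, (t j)⁻¹ * hsB d (P j) x * hsB d (P j) y := fun x y => by
    rw [hFx]
    simp [map_sum, LinearMap.sum_apply]
  have hPu : ∀ j, hsB d (P j) u = t j := fun j => by
    simp [hsB_apply, hu, hermOne, ht]
  have huu : hsB d u u = d := by simp [hsB_apply, hu, hermOne]
  have hsum' : ∑ j, P j = u := by
    apply Subtype.ext
    rw [AddSubmonoidClass.coe_finsetSum, hsum]
    rfl
  have hFu : F u = (d : ℝ) • u := by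
    rw [hFx, ← hsum']
    congr 1
    refine Finset.sum_congr rfl fun j _ => ?_
    rw [hsum', hPu, inv_mul_cancel₀ (htrpos j).ne', one_smul]
  have hFG' : ∀ x, F (G x) = x := fun x => LinearMap.congr_fun hFG x
  have hGF' : ∀ x, G (F x) = x := fun x => LinearMap.congr_fun hGF x
  have hFs : ∀ x y, hsB d (F x) y = hsB d x (F y) := fun x y => by
    rw [hsB_symm d x (F y), hBF, hBF]
    congr 1
    exact Finset.sum_congr rfl fun j _ => by ring
  have hnn : ∀ x j, 0 ≤ (t j)⁻¹ * hsB d (P j) x * hsB d (P j) x := fun x j => by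
    rw [mul_assoc]
    exact mul_nonneg (inv_nonneg.2 (htrpos j).le) (mul_self_nonneg _)
  have hFp : ∀ x, x ≠ 0 → 0 < hsB d (F x) x := fun x hx => by
    rw [hBF]
    refine mul_pos hd0 (lt_of_le_of_ne (Finset.sum_nonneg fun j _ => hnn x j) fun h0 => hx ?_)
    have h0 := (Finset.sum_eq_zero_iff_of_nonneg fun j _ => hnn x j).1 h0.symm
    rw [← hGF' x, hFx, Finset.sum_eq_zero, smul_zero, map_zero]
    intro j hj
    have h1 := h0 j hj
    have h2 : hsB d (P j) x = 0 := by
      rw [mul_assoc, mul_eq_zero, mul_self_eq_zero] at h1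
      exact h1.resolve_left (inv_ne_zero (htrpos j).ne')
    rw [h2, mul_zero, zero_smul]
  have htrF : LinearMap.trace ℝ (HermM d) F = (d : ℝ) ^ 2 * 𝓅 := by
    rw [hF, h𝓅]
    simp only [map_smul, map_sum, outer_eq, LinearMap.trace_smulRight, smul_eq_mul, hsB_apply]
    have : ∀ j, (t j)⁻¹ * (Matrix.trace ((P j : Mat d) * (P j : Mat d))).re =
      (Matrix.trace ((P j : Mat d) * (P j : Mat d))).re / t j := fun j => by
        rw [div_eq_inv_mul]
    simp only [this]
    field_simp
    rfl
  have hp1 : 𝓅 ≤ 1 := by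
    rw [h𝓅, div_le_one hd0, ← huu, ← hsum']
    nth_rewrite 2 [map_sum]
    rw [hsum', LinearMap.sum_apply]
    refine Finset.sum_le_sum fun j _ => ?_
    rw [hPu, div_le_iff₀ (htrpos j)]
    exact (hsB_le d (P j) (hpsd j)).trans_eq (pow_two _)
  have hfr : (Module.finrank ℝ (HermM d) : ℝ) = (d : ℝ) ^ 2 := by
    rw [aux_finrank]; push_cast; rfl
  have main := fun α β => aux_main (hsB d) (hsB_symm d) (hsB_pos d) F G hFp hFs hFG' hGF' u d α β
    hd0 hFu huu
  rw [htrF, hfr] at main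
  have hpos : 0 < (d : ℝ) ^ 2 * 𝓅 - d := by
    obtain ⟨h1, h2⟩ := main 0 1
    refine lt_of_le_of_ne (by linarith) fun h0 => ?_
    have h3 := h2.1 (by linarith)
    have h4 : LinearMap.trace ℝ (HermM d) (G ∘ₗ F) = 1 := by
      have h5 : G ∘ₗ F = (hsB d u).smulRight (G u) := by
        rw [h3]
        ext1 x
        simp
      have h6 : G u = (d : ℝ)⁻¹ • u := by
        have := hGF' u
        rw [hFu, map_smul] at this
        rw [← this, smul_smul, inv_mul_cancel₀ hd0.ne', one_smul, this]
      rw [h5, LinearMap.trace_smulRight, h6, map_smul, huu, smul_eq_mul, inv_mul_cancel₀ hd0.ne']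
    have h5 : G ∘ₗ F = LinearMap.id := hGF
    rw [h5, LinearMap.trace_id, hfr] at h4
    linarith
  obtain ⟨α, hα⟩ : ∃ α : ℝ, α = ((d : ℝ) ^ 2 * 𝓅 - d) / ((d : ℝ) ^ 2 - 1) := ⟨_, rfl⟩
  have hα0 : 0 < α := hα ▸ div_pos hpos hm
  have hαe : (d : ℝ) ^ 2 * 𝓅 = α * ((d : ℝ) ^ 2 - 1) + d := by
    rw [hα]; field_simp; ring
  have hR : ((d : ℝ) ^ 2 - 1) ^ 2 / ((d : ℝ) ^ 2 * 𝓅 - d) = ((d : ℝ) ^ 2 - 1) / α := by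
    rw [hαe, add_sub_cancel_right]; field_simp
  have hβ0 : 0 < 1 - α / d := by
    have : α < d := by
      rw [hα, div_lt_iff₀ hm]
      nlinarith [mul_le_mul_of_nonneg_left hp1 (sq_nonneg (d : ℝ))]
    rw [sub_pos, div_lt_one hd0]
    exact this
  obtain ⟨m1, m2⟩ := main α (1 - α / d)
  set T := LinearMap.trace ℝ (HermM d) G with hT
  have hexp : (d : ℝ) ^ 2 * 𝓅 - 2 * α * (d : ℝ) ^ 2 - 2 * (1 - α / d) * d + 2 * α * (1 - α / d)
      + (1 - α / d) ^ 2 * d + α ^ 2 * T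
      = α ^ 2 * (T - 1 / d - ((d : ℝ) ^ 2 - 1) / α) := by
    rw [hαe]; field_simp; ring
  rw [hexp] at m1 m2
  have hα2 : 0 < α ^ 2 := by positivity
  rw [hR]
  refine ⟨?_, fun h => ?_, ?_⟩
  · have := nonneg_of_mul_nonneg_right m1 hα2
    linarith
  · refine ⟨α, 1 - α / d, hα0, hβ0, ?_⟩
    rw [outer_eq]
    exact m2.1 (by rw [mul_eq_zero]; right; linarith)
  · rintro ⟨a, b, ha, hb, h⟩
    rw [outer_eq] at h
    have e1 : (d : ℝ) = a + b * d := by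
      have h1 : hsB d u (F u) = d * (a + b * d) := by
        rw [h]
        simp [huu]
        ring
      rw [hFu, map_smul, huu, smul_eq_mul] at h1
      exact mul_left_cancel₀ hd0.ne' h1
    have e2 : (d : ℝ) ^ 2 * 𝓅 = a * (d : ℝ) ^ 2 + b * d := by
      rw [← htrF, h]
      simp only [map_add, map_smul, LinearMap.trace_id, LinearMap.trace_smulRight, smul_eq_mul, hfr]
      rw [huu]
    have ea : a = α := by
      rw [hα, eq_div_iff hm.ne']
      linarith
    have eb : b = 1 - α / d := by
      rw [← ea]; field_simp; linarith
    rw [ea, eb] at h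
    have h3 := m2.2 h
    have h4 := (mul_eq_zero.1 h3).resolve_left hα2.ne'
    linarith
end
end
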